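/- For every real α > −1, the series Σ_{i=1}^∞ c_{2i}^*(α,−1) converges and equals 2·Σ_{i=0}^∞ (−α−1)_{2i}·2^{2i}/((2i)!·(3)_{2i}), and likewise Σ_{i=0}^∞ c_{2i+1}^*(α,−1) = 2·Σ_{i=0}^∞ (−α−1)_{2i+1}·2^{2i+1}/((2i+1)!·(3)_{2i+1}). -/

import Mathlib

open Finset

/-- Generalized binomial coefficient `C(z, k)` for real `z` and integer `k`,
equal to `z (z-1) ⋯ (z-k+1) / k!` for `k ≥ 0` and `0` for `k < 0`. -/
noncomputable def gbinom (z : ℝ) (k : ℤ) : ℝ :=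
  if 0 ≤ k then (∏ j ∈ Finset.range k.toNat, (z - (j : ℝ))) / (Nat.factorial k.toNat : ℝ)
  else 0

/-- Pochhammer symbol `(z)_k = z (z+1) ⋯ (z+k-1)`. -/
noncomputable def poch (z : ℝ) (k : ℕ) : ℝ :=
  ∏ j ∈ Finset.range k, (z + (j : ℝ))

/-- Classical Laguerre polynomial `L_n^α(x) = ∑_{k=0}^n (-1)^k C(n+α, n-k) x^k / k!`. -/
noncomputable def laguerre (α : ℝ) (n : ℕ) (x : ℝ) : ℝ :=
  ∑ k ∈ Finset.range (n + 1),
    (-1 : ℝ) ^ k * gbinom ((n : ℝ) + α) ((n : ℤ) - (k : ℤ)) * x ^ k / (Nat.factorial k : ℝ)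

/-- The coefficient functions `a_i(α, x)` for `i ≥ 1`. -/
noncomputable def aFun (α : ℝ) (i : ℕ) (x : ℝ) : ℝ :=
  (1 / (Nat.factorial i : ℝ)) * ∑ j ∈ Finset.Icc 1 i,
    (-1 : ℝ) ^ (i + j + 1) * gbinom (α + 1) ((j : ℤ) - 1) *
      gbinom (α + 2) ((i : ℤ) - (j : ℤ)) * poch (α + 3) (i - j) * x ^ j

/-- The Gauss hypergeometric series `₂F₁(a, b; c; z) = ∑_{k=0}^∞ (a)_k (b)_k z^k / ((c)_k k!)`
(used here only with `a` a nonpositive integer, so the series terminates). -/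
noncomputable def hyp2F1 (a b c z : ℝ) : ℝ :=
  ∑' k : ℕ, poch a k * poch b k * z ^ k / (poch c k * (Nat.factorial k : ℝ))

/-- The confluent hypergeometric series `₁F₁(a; b; z) = ∑_{k=0}^∞ (a)_k z^k / ((b)_k k!)`. -/
noncomputable def hyp1F1 (a b z : ℝ) : ℝ :=
  ∑' k : ℕ, poch a k * z ^ k / (poch b k * (Nat.factorial k : ℝ))

/-- `c_{2i}^*(α,x) = (4(-1)^{i+1}/(2i)!) C(α+1, i-1) ₂F₁(-i+1, α+5/2-i; 1/2; x²)` for `i ≥ 1`. -/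
noncomputable def cStarEven (α : ℝ) (i : ℕ) (x : ℝ) : ℝ :=
  (4 * (-1 : ℝ) ^ (i + 1) / (Nat.factorial (2 * i) : ℝ)) * gbinom (α + 1) ((i : ℤ) - 1) *
    hyp2F1 (-(i : ℝ) + 1) (α + 5 / 2 - (i : ℝ)) (1 / 2) (x ^ 2)

/-- `c_{2i+1}^*(α,x) = (8(-1)^{i+1}/(2i+1)!) C(α, i-1) (α+1) x ₂F₁(-i+1, α+5/2-i; 3/2; x²)`
for `i ≥ 1`. -/
noncomputable def cStarOdd (α : ℝ) (i : ℕ) (x : ℝ) : ℝ :=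
  (8 * (-1 : ℝ) ^ (i + 1) / (Nat.factorial (2 * i + 1) : ℝ)) * gbinom α ((i : ℤ) - 1) *
    (α + 1) * x * hyp2F1 (-(i : ℝ) + 1) (α + 5 / 2 - (i : ℝ)) (3 / 2) (x ^ 2)

/-- The functions `c_m^*(α,x)`: equal to `c_{2i}^*` for `m = 2i`, to `0` for `m = 1`,
and to `c_{2i+1}^*` for odd `m = 2i+1 ≥ 3`. -/
noncomputable def cS (α : ℝ) (m : ℕ) (x : ℝ) : ℝ :=
  if m = 1 then 0
  else if m % 2 = 0 then cStarEven α (m / 2) x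
  else cStarOdd α (m / 2) x

theorem poch_zero (z : ℝ) : poch z 0 = 1 := by simp [poch]

theorem poch_succ (z : ℝ) (k : ℕ) : poch z (k + 1) = poch z k * (z + k) := by
  simp [poch, Finset.prod_range_succ]

theorem poch_succ_left (z : ℝ) (k : ℕ) : poch z (k + 1) = z * poch (z + 1) k := by
  simp only [poch, Finset.prod_range_succ', Nat.cast_zero, add_zero]
  rw [mul_comm]
  congr 1
  refine Finset.prod_congr rfl fun j _ => ?_
  push_cast
  ring

theorem poch_add (z : ℝ) (m n : ℕ) : poch z (m + n) = poch z m * poch (z + m) n := by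
  simp [poch, Finset.prod_range_add, add_assoc]

theorem poch_pos {z : ℝ} (hz : 0 < z) (k : ℕ) : 0 < poch z k :=
  Finset.prod_pos fun _ _ => by positivity

theorem poch_neg_natCast_eq_zero {n k : ℕ} (h : n < k) : poch (-(n : ℝ)) k = 0 :=
  Finset.prod_eq_zero (Finset.mem_range.2 h) (by simp)

theorem poch_half (n : ℕ) :
    poch (1 / 2) n * (4 ^ n * (n.factorial : ℝ)) = ((2 * n).factorial : ℝ) := by
  induction n with
  | zero => simp [poch_zero]
  | succ n ih =>
    rw [poch_succ, show 2 * (n + 1) = 2 * n + 1 + 1 by ring, Nat.factorial_succ,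
      Nat.factorial_succ, Nat.factorial_succ]
    push_cast
    rw [← ih]
    ring

theorem poch_three_halves (n : ℕ) :
    poch (3 / 2) n * (4 ^ n * (n.factorial : ℝ)) = ((2 * n + 1).factorial : ℝ) := by
  induction n with
  | zero => simp [poch_zero]
  | succ n ih =>
    rw [poch_succ, show 2 * (n + 1) + 1 = 2 * n + 1 + 1 + 1 by ring, Nat.factorial_succ (_ + 1 + 1),
      Nat.factorial_succ (_ + 1), Nat.factorial_succ n]
    push_cast
    rw [← ih]
    ring

theorem poch_three (k : ℕ) : 2 * poch 3 k = ((k + 2).factorial : ℝ) := by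
  induction k with
  | zero => simp [poch_zero]
  | succ k ih =>
    rw [poch_succ, show k + 1 + 2 = k + 2 + 1 by ring, Nat.factorial_succ]
    push_cast
    rw [← ih]
    ring

theorem neg_one_pow_mul_gbinom (z : ℝ) (n : ℕ) :
    (-1) ^ n * gbinom z n = poch (-z) n / n.factorial := by
  have h : poch (-z) n = (-1) ^ n * ∏ j ∈ Finset.range n, (z - (j : ℝ)) := by
    rw [poch, ← Finset.card_range n, ← Finset.prod_const, Finset.card_range,
      ← Finset.prod_mul_distrib]
    exact Finset.prod_congr rfl fun j _ => by ring
  rw [h]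
  simp [gbinom, mul_div_assoc]

/-- Contiguous relation for the partial sums of `₂F₁` at `1`. -/
theorem sum_hyp2F1_sub_one (a b : ℝ) {c : ℝ} (hc : 0 < c) (N : ℕ) :
    ∑ k ∈ Finset.range (N + 1), poch (a - 1) k * poch b k / (poch c k * (k.factorial : ℝ)) =
      ∑ k ∈ Finset.range (N + 1), poch a k * poch b k / (poch c k * (k.factorial : ℝ)) -
        b / c * ∑ k ∈ Finset.range N,
          poch a k * poch (b + 1) k / (poch (c + 1) k * (k.factorial : ℝ)) := by
  rw [Finset.sum_range_succ', Finset.sum_range_succ' (fun k => poch a k * _ / _), Finset.mul_sum,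
    add_sub_right_comm, ← Finset.sum_sub_distrib]
  congr 1
  refine Finset.sum_congr rfl fun k _ => ?_
  have h1 := poch_pos (show 0 < c + 1 by linarith) k
  rw [poch_succ_left (a - 1), poch_succ a, poch_succ_left b, poch_succ_left c, sub_add_cancel,
    Nat.factorial_succ]
  push_cast
  field_simp
  ring

/-- The Chu–Vandermonde identity, for partial sums. -/
theorem sum_chu_vandermonde (n : ℕ) : ∀ (N : ℕ) (b c : ℝ), n < N → 0 < c →
    ∑ k ∈ Finset.range N, poch (-(n : ℝ)) k * poch b k / (poch c k * (k.factorial : ℝ)) =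
      poch (c - b) n / poch c n := by
  induction n with
  | zero =>
    intro N b c hN _
    rw [Finset.sum_eq_single_of_mem 0 (Finset.mem_range.2 hN)]
    · simp [poch_zero]
    · intro k _ hk
      rw [poch_neg_natCast_eq_zero (Nat.pos_of_ne_zero hk)]
      simp
  | succ n ih =>
    intro N b c hN hc
    obtain ⟨N, rfl⟩ : ∃ M, N = M + 1 := ⟨N - 1, by omega⟩
    rw [show (-((n + 1 : ℕ) : ℝ)) = -(n : ℝ) - 1 by push_cast; ring,
      sum_hyp2F1_sub_one _ _ hc, ih _ _ _ (by omega) hc, ih _ _ _ (by omega) (by linarith),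
      add_sub_add_right_eq_sub]
    have h1 := poch_pos (show 0 < c + 1 by linarith) n
    have h2 := poch_pos hc n
    have h3 : poch c n * (c + n) = c * poch (c + 1) n := by
      rw [← poch_succ, poch_succ_left]
    have h4 : 0 < c + n := by positivity
    have h5 : poch (c + 1) n = poch c n * (c + n) / c := by
      rw [h3]
      field_simp
    rw [h5, poch_succ, poch_succ]
    field_simp
    ring

theorem hyp2F1_neg_natCast_one (n : ℕ) (b : ℝ) {c : ℝ} (hc : 0 < c) :
    hyp2F1 (-(n : ℝ)) b c 1 = poch (c - b) n / poch c n := by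
  rw [hyp2F1, tsum_eq_sum (s := Finset.range (n + 1)),
    ← sum_chu_vandermonde n (n + 1) b c (by omega) hc]
  · simp
  · intro k hk
    rw [poch_neg_natCast_eq_zero (by simpa using hk)]
    simp

theorem summable_poch_mul_two_pow_div (b : ℝ) :
    Summable fun k : ℕ => poch b k * 2 ^ k / ((k.factorial : ℝ) * poch 3 k) := by
  refine summable_of_ratio_norm_eventually_le (r := 1 / 2) (by norm_num) ?_
  filter_upwards [Filter.eventually_ge_atTop 1, Filter.eventually_ge_atTop ⌈4 * |b|⌉₊] with k h1 hk
  have h1' : (1 : ℝ) ≤ k := by exact_mod_cast h1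
  have hk' : 4 * |b| ≤ k := Nat.ceil_le.1 hk
  have h3 := poch_pos (show (0 : ℝ) < 3 by norm_num) k
  have hstep : poch b (k + 1) * 2 ^ (k + 1) / (((k + 1).factorial : ℝ) * poch 3 (k + 1)) =
      2 * (b + k) / ((k + 1) * (3 + k)) *
        (poch b k * 2 ^ k / ((k.factorial : ℝ) * poch 3 k)) := by
    rw [poch_succ, poch_succ, Nat.factorial_succ, pow_succ]
    push_cast
    field_simp
  rw [hstep, norm_mul]
  refine mul_le_mul_of_nonneg_right ?_ (norm_nonneg _)
  rw [Real.norm_eq_abs, abs_div, abs_mul, abs_two,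
    abs_of_pos (show (0 : ℝ) < (k + 1) * (3 + k) by positivity), div_le_iff₀ (by positivity)]
  have : |b + k| ≤ |b| + k := (abs_add_le _ _).trans (by simp)
  nlinarith

theorem cStarEven_succ_neg_one (α : ℝ) (n : ℕ) :
    cStarEven α (n + 1) (-1) = 2 * (poch (-α - 1) (2 * n) * 2 ^ (2 * n) /
        ((Nat.factorial (2 * n) : ℝ) * poch 3 (2 * n))) := by
  have hg := neg_one_pow_mul_gbinom (α + 1) n
  have h3 := poch_three (2 * n)
  have h2 := poch_half n
  have hp := poch_pos (show (0 : ℝ) < 1 / 2 by norm_num) n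
  have hq := poch_pos (show (0 : ℝ) < 3 by norm_num) (2 * n)
  rw [cStarEven, show (-((n + 1 : ℕ) : ℝ) + 1) = -(n : ℝ) by push_cast; ring,
    show ((-1 : ℝ) ^ 2) = 1 by norm_num, hyp2F1_neg_natCast_one _ _ (by norm_num),
    show ((n + 1 : ℕ) : ℤ) - 1 = n by push_cast; ring,
    show 2 * (n + 1) = 2 * n + 2 by ring, ← h3, ← h2,
    show (2 * n : ℕ) = n + n by ring, poch_add (-α - 1),
    show (1 / 2 - (α + 5 / 2 - ((n + 1 : ℕ) : ℝ))) = -α - 1 + n by push_cast; ring,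
    show 4 * (-1 : ℝ) ^ (n + 1 + 1) / (2 * poch 3 (n + n)) * gbinom (α + 1) n =
      4 / (2 * poch 3 (n + n)) * ((-1) ^ n * gbinom (α + 1) n) by ring, hg,
    show -(α + 1) = -α - 1 by ring, ← two_mul, pow_mul]
  field_simp
  norm_num

theorem cStarOdd_succ_neg_one (α : ℝ) (n : ℕ) :
    cStarOdd α (n + 1) (-1) = 2 * (poch (-α - 1) (2 * n + 1) * 2 ^ (2 * n + 1) /
        ((Nat.factorial (2 * n + 1) : ℝ) * poch 3 (2 * n + 1))) := by
  have hg := neg_one_pow_mul_gbinom α n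
  have h3 := poch_three (2 * n + 1)
  have h2 := poch_three_halves n
  have hp := poch_pos (show (0 : ℝ) < 3 / 2 by norm_num) n
  have hq := poch_pos (show (0 : ℝ) < 3 by norm_num) (2 * n + 1)
  have hs : poch (-α - 1) (2 * n + 1) = (-α - 1) * (poch (-α) n * poch (-α + n) n) := by
    rw [poch_succ_left, two_mul, poch_add, sub_add_cancel]
  rw [cStarOdd, show (-((n + 1 : ℕ) : ℝ) + 1) = -(n : ℝ) by push_cast; ring,
    show ((-1 : ℝ) ^ 2) = 1 by norm_num, hyp2F1_neg_natCast_one _ _ (by norm_num),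
    show ((n + 1 : ℕ) : ℤ) - 1 = n by push_cast; ring,
    show 2 * (n + 1) + 1 = 2 * n + 1 + 2 by ring, ← h3, ← h2, hs,
    show (3 / 2 - (α + 5 / 2 - ((n + 1 : ℕ) : ℝ))) = -α + n by push_cast; ring,
    show 8 * (-1 : ℝ) ^ (n + 1 + 1) / (2 * poch 3 (2 * n + 1)) * gbinom α n =
      8 / (2 * poch 3 (2 * n + 1)) * ((-1) ^ n * gbinom α n) by ring, hg,
    pow_succ, pow_mul]
  field_simp
  ring

theorem cS_two_mul_succ_add_one (α x : ℝ) (n : ℕ) :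
    cS α (2 * (n + 1) + 1) x = cStarOdd α (n + 1) x := by
  rw [cS, if_neg (by omega), if_neg (by omega), show (2 * (n + 1) + 1) / 2 = n + 1 by omega]

/-- `∑_{i=1}^∞ c_{2i}^*(α,-1) = 2 ∑_{i=0}^∞ (-α-1)_{2i} 2^{2i} / ((2i)! (3)_{2i})` and
`∑_{i=0}^∞ c_{2i+1}^*(α,-1) = 2 ∑_{i=0}^∞ (-α-1)_{2i+1} 2^{2i+1} / ((2i+1)! (3)_{2i+1})`. -/
theorem statement19 (α : ℝ) (hα : -1 < α) :
    HasSum (fun i : ℕ => cStarEven α (i + 1) (-1))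
      (2 * ∑' i : ℕ, poch (-α - 1) (2 * i) * 2 ^ (2 * i) /
        ((Nat.factorial (2 * i) : ℝ) * poch 3 (2 * i))) ∧
    HasSum (fun i : ℕ => cS α (2 * i + 1) (-1))
      (2 * ∑' i : ℕ, poch (-α - 1) (2 * i + 1) * 2 ^ (2 * i + 1) /
        ((Nat.factorial (2 * i + 1) : ℝ) * poch 3 (2 * i + 1))) := by
  have hs := summable_poch_mul_two_pow_div (-α - 1)
  constructor
  · simp only [cStarEven_succ_neg_one]
    exact ((hs.comp_injective (i := fun n : ℕ => 2 * n)
      (fun m n h => by simpa using h)).hasSum).mul_left 2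
  · rw [← hasSum_nat_add_iff' 1]
    simp only [cS_two_mul_succ_add_one, cStarOdd_succ_neg_one, Finset.sum_range_one, mul_zero,
      zero_add]
    rw [show cS α 1 (-1) = 0 by simp [cS], sub_zero]
    exact ((hs.comp_injective (i := fun n : ℕ => 2 * n + 1)
      (fun m n h => by simpa using h)).hasSum).mul_left 2
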